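/- arXiv:2311.00649 — 4 statements merged into one kernel-verified Lean document; each statement's English description precedes it below -/
import Mathlib

section
/- Let Γ be a countably infinite amenable group acting continuously on an infinite compact metrizable space X. If the action is almost finite in measure and has dynamical comparison, then the action is almost finite. -/
open scoped Pointwise
open MeasureTheory

namespace Paper

section Basic

variable (G : Type*) [Group G] (X : Type*) [TopologicalSpace X] [MulAction G X]

/-- The action is minimal: every orbit is dense. -/
def Minimal : Prop := ∀ x : X, Dense (MulAction.orbit G x)

/-- The action is topologically free: every nontrivial fixed-point set is nowhere dense. -/
def TopFree : Prop := ∀ g : G, g ≠ 1 → interior (closure {x : X | g • x = x}) = (∅ : Set X)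

variable [MeasurableSpace X]

/-- `μ` is a `G`-invariant Borel probability measure. -/
def InvProb (μ : Measure X) : Prop :=
  IsProbabilityMeasure μ ∧ ∀ g : G, Measure.map (fun x : X => g • x) μ = μ

/-- The action is essentially free. -/
def EssFree : Prop :=
  ∀ g : G, g ≠ 1 → ∀ μ : Measure X, InvProb G X μ → μ {x : X | g • x = x} = 0

/-- The small boundary property. -/
def SBP : Prop :=
  ∀ (x : X) (U : Set X), IsOpen U → x ∈ U →
    ∃ V : Set X, IsOpen V ∧ x ∈ V ∧ V ⊆ U ∧
      ∀ μ : Measure X, InvProb G X μ → μ (frontier V) = 0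

end Basic

/-- `S` is a `(K, ε)`-Følner set: `|KS \ S| < ε |S|`. -/
def IsFolner {G : Type*} [Group G] (K S : Finset G) (ε : ℝ) : Prop :=
  letI := Classical.decEq G
  (((K * S) \ S).card : ℝ) < ε * S.card

/-- Amenability in the Følner sense. -/
def FolnerAmenable (G : Type*) [Group G] : Prop :=
  ∀ (K : Finset G) (ε : ℝ), 0 < ε → ∃ S : Finset G, IsFolner K S ε

/-- A finite family of towers forming a castle: all levels are pairwise disjoint. -/
def IsCastle (G : Type*) [Group G] (X : Type*) [MulAction G X] {n : ℕ}
    (S : Fin n → Finset G) (B : Fin n → Set X) : Prop :=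
  ∀ (i j : Fin n), ∀ s ∈ S i, ∀ t ∈ S j, (i, s) ≠ (j, t) → Disjoint (s • B i) (t • B j)

/-- The union of all levels of a castle. -/
def CastleUnion (G : Type*) [Group G] (X : Type*) [MulAction G X] {n : ℕ}
    (S : Fin n → Finset G) (B : Fin n → Set X) : Set X :=
  ⋃ i, ⋃ s ∈ S i, s • B i

/-- `C ≺ O` : dynamical subordination of a (closed) set `C` to `O`. -/
def Subord (G : Type*) [Group G] (X : Type*) [TopologicalSpace X] [MulAction G X]
    (C O : Set X) : Prop :=
  ∃ (n : ℕ) (V : Fin n → Set X) (g : Fin n → G),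
    (∀ k, IsOpen (V k)) ∧ (C ⊆ ⋃ k, V k) ∧ (∀ k, g k • V k ⊆ O) ∧
      Pairwise fun k l => Disjoint (g k • V k) (g l • V l)

/-- `U ≺ O` for open `U`: every closed subset of `U` is subordinate to `O`. -/
def SubordOpen (G : Type*) [Group G] (X : Type*) [TopologicalSpace X] [MulAction G X]
    (U O : Set X) : Prop :=
  ∀ C : Set X, IsClosed C → C ⊆ U → Subord G X C O

/-- Dynamical comparison. -/
def DynComparison (G : Type*) [Group G] (X : Type*) [TopologicalSpace X] [MulAction G X]
    [MeasurableSpace X] : Prop :=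
  ∀ U O : Set X, IsOpen U → IsOpen O → U.Nonempty → O.Nonempty →
    (∀ μ : Measure X, InvProb G X μ → μ U < μ O) → SubordOpen G X U O

/-- Almost finiteness (Kerr). -/
def AlmostFinite (G X : Type*) [Group G] [MetricSpace X] [MulAction G X] : Prop :=
  ∀ (K : Finset G) (m : ℕ), 0 < m → ∀ ε : ℝ, 0 < ε →
    ∃ (n : ℕ) (S : Fin n → Finset G) (B : Fin n → Set X),
      IsCastle G X S B ∧ (∀ i, IsOpen (B i)) ∧ (∀ i, IsFolner K (S i) ε) ∧
      (∀ i, ∀ s ∈ S i, Metric.diam (s • B i) < ε) ∧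
      ∃ S' : Fin n → Finset G,
        (∀ i, S' i ⊆ S i ∧ ((S' i).card : ℝ) < (S i).card / m) ∧
        Subord G X (Set.univ \ CastleUnion G X S B) (CastleUnion G X S' B)

/-- Almost finiteness in measure (Kerr–Szabó). -/
def AlmostFiniteInMeasure (G X : Type*) [Group G] [MetricSpace X] [MulAction G X]
    [MeasurableSpace X] : Prop :=
  ∀ (K : Finset G) (ε : ℝ), 0 < ε →
    ∃ (n : ℕ) (S : Fin n → Finset G) (B : Fin n → Set X),
      IsCastle G X S B ∧ (∀ i, IsOpen (B i)) ∧ (∀ i, IsFolner K (S i) ε) ∧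
      (∀ i, ∀ s ∈ S i, Metric.diam (s • B i) < ε) ∧
      (⨆ μ : {μ : Measure X // InvProb G X μ},
        (μ : Measure X) (Set.univ \ CastleUnion G X S B)) < ENNReal.ofReal ε

/-- Every finitely generated subgroup is finite. -/
def LocallyFiniteGroup (G : Type*) [Group G] : Prop :=
  ∀ H : Subgroup G, H.FG → (H : Set G).Finite

/-- `G` is virtually `ℤ`. -/
def VirtuallyZ (G : Type*) [Group G] : Prop :=
  ∃ H : Subgroup G, H.FiniteIndex ∧ Nonempty (H ≃* Multiplicative ℤ)

end Paper

open Paper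

section Folner

variable {G : Type*} [Group G]

theorem Paper.IsFolner.mono {K L S : Finset G} {δ ε : ℝ} (h : IsFolner L S δ) (hKL : K ⊆ L)
    (hδ : δ ≤ ε) : IsFolner K S ε := by
  classical
  unfold IsFolner at *
  have h1 : (((K * S) \ S).card : ℝ) ≤ ((L * S) \ S).card := by
    exact_mod_cast Finset.card_le_card
      (Finset.sdiff_subset_sdiff (Finset.mul_subset_mul_right hKL) le_rfl)
  have h2 : δ * (S.card : ℝ) ≤ ε * S.card := by gcongr
  convert (h1.trans_lt (by convert h)).trans_le h2

theorem Paper.IsFolner.card_mul_lt [DecidableEq G] {K S : Finset G} {ε : ℝ} (h : IsFolner K S ε)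
    (hε : ε ≤ 1) : (K * S).card < 2 * S.card := by
  have h' : (((K * S) \ S).card : ℝ) < ε * S.card := by
    unfold IsFolner at h
    convert h
  have h1 : ((K * S) \ S).card < S.card := by
    have : ε * (S.card : ℝ) ≤ 1 * S.card := by gcongr
    exact_mod_cast (h'.trans_le this).trans_eq (one_mul _)
  have h2 : (K * S).card - S.card ≤ ((K * S) \ S).card := Finset.le_card_sdiff _ _
  omega

theorem Paper.IsFolner.card_lt {K S : Finset G} {ε : ℝ} (h : IsFolner K S ε) (hε : ε ≤ 1) :
    K.card < 2 * S.card := by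
  classical
  have h1 := h.card_mul_lt hε
  have hS : S.Nonempty := Finset.card_pos.1 (by omega)
  exact (Finset.card_le_card_mul_right hS).trans_lt h1

end Folner

section Subord

variable {G : Type*} [Group G] {X : Type*} [TopologicalSpace X] [MulAction G X]

/-- A subordination of the whole space to `O` lifts along an orbit to an injection of `G`
with finitely many displacements. -/
theorem Paper.Subord.exists_injective {O : Set X} (h : Subord G X Set.univ O) (x : X) :
    ∃ (F : Finset G) (f : G → G), Function.Injective f ∧ (∀ g, ∃ a ∈ F, f g = a * g) ∧
      ∀ g, f g • x ∈ O := by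
  classical
  obtain ⟨n, V, a, -, hcov, hO, hdisj⟩ := h
  have hex : ∀ g : G, ∃ k, g • x ∈ V k := fun g => Set.mem_iUnion.1 (hcov (Set.mem_univ _))
  choose k hk using hex
  have hmem : ∀ g, (a (k g) * g) • x ∈ a (k g) • V (k g) := fun g => by
    rw [mul_smul]
    exact Set.smul_mem_smul_set (hk g)
  refine ⟨Finset.univ.image a, fun g => a (k g) * g, fun g g' hgg => ?_,
    fun g => ⟨_, Finset.mem_image_of_mem _ (Finset.mem_univ _), rfl⟩,
    fun g => hO _ (hmem g)⟩
  have hkk : k g = k g' := by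
    by_contra hne
    refine Set.disjoint_left.1 (hdisj hne) (hmem g) ?_
    have := hmem g'
    simp only at hgg
    rwa [← hgg] at this
  simpa [hkk] using hgg

/-- Actions of amenable groups admit no paradoxical decompositions. -/
theorem Paper.FolnerAmenable.not_subord_of_disjoint (ham : FolnerAmenable G) [Nonempty X]
    {O P : Set X} (hOP : Disjoint O P) (hO : Subord G X Set.univ O)
    (hP : Subord G X Set.univ P) : False := by
  classical
  obtain ⟨x⟩ := ‹Nonempty X›
  obtain ⟨F, f, hf, hfF, hfO⟩ := hO.exists_injective x
  obtain ⟨F', f', hf', hfF', hfP⟩ := hP.exists_injective x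
  obtain ⟨S, hS⟩ := ham (F ∪ F') 1 one_pos
  have hcard := hS.card_mul_lt le_rfl
  have hdisj : Disjoint (S.image f) (S.image f') := by
    rw [Finset.disjoint_left]
    rintro _ hg hg'
    obtain ⟨g, -, rfl⟩ := Finset.mem_image.1 hg
    obtain ⟨g', -, hgg⟩ := Finset.mem_image.1 hg'
    exact Set.disjoint_left.1 hOP (hfO g) (hgg ▸ hfP g')
  have hsub : S.image f ∪ S.image f' ⊆ (F ∪ F') * S := by
    refine Finset.union_subset ?_ ?_ <;> intro y hy <;>
      obtain ⟨g, hg, rfl⟩ := Finset.mem_image.1 hy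
    · obtain ⟨a, ha, h⟩ := hfF g
      rw [h]
      exact Finset.mul_mem_mul (Finset.mem_union_left _ ha) hg
    · obtain ⟨a, ha, h⟩ := hfF' g
      rw [h]
      exact Finset.mul_mem_mul (Finset.mem_union_right _ ha) hg
  have h := Finset.card_le_card hsub
  rw [Finset.card_union_of_disjoint hdisj, Finset.card_image_of_injective _ hf,
    Finset.card_image_of_injective _ hf'] at h
  omega

/-- An amenable action with dynamical comparison on a space with at least two points has an
invariant probability measure. -/
theorem Paper.DynComparison.exists_invProb [MeasurableSpace X] [T2Space X] [Nontrivial X]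
    (h : DynComparison G X) (ham : FolnerAmenable G) : ∃ μ : Measure X, InvProb G X μ := by
  by_contra! hno
  obtain ⟨x, y, hxy⟩ := exists_pair_ne X
  obtain ⟨O, P, hO, hP, hx, hy, hOP⟩ := t2_separation hxy
  have key : ∀ W : Set X, IsOpen W → W.Nonempty → Subord G X Set.univ W := fun W hW hne =>
    h _ _ isOpen_univ hW Set.univ_nonempty hne (fun μ hμ => (hno μ hμ).elim) _
      isClosed_univ le_rfl
  exact ham.not_subord_of_disjoint hOP (key O hO ⟨x, hx⟩) (key P hP ⟨y, hy⟩)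

end Subord

section Invariant

variable {G : Type*} [Group G] {X : Type*} [MulAction G X]

theorem isClosed_setOf_le_probabilityMeasure_apply [TopologicalSpace X] [MeasurableSpace X]
    [OpensMeasurableSpace X] [HasOuterApproxClosed X] {C : Set X} (hC : IsClosed C)
    (c : ENNReal) : IsClosed {μ : ProbabilityMeasure X | c ≤ (μ : Measure X) C} := by
  rw [isClosed_iff_ultrafilter]
  intro μ u hu hmem
  refine le_trans ?_ (ProbabilityMeasure.limsup_measure_closed_le_of_tendsto
    (L := (u : Filter (ProbabilityMeasure X))) (μs := id) hu hC)
  have hev : ∀ᶠ ν : ProbabilityMeasure X in u, c ≤ (ν : Measure X) C := hmem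
  exact Filter.le_limsup_of_frequently_le' hev.frequently

theorem isClosed_setOf_invProb [TopologicalSpace X] [MeasurableSpace X] [BorelSpace X]
    [HasOuterApproxClosed X] [ContinuousConstSMul G X] :
    IsClosed {μ : ProbabilityMeasure X | InvProb G X μ} := by
  have : {μ : ProbabilityMeasure X | InvProb G X μ} =
      ⋂ g : G, {μ | μ.map (continuous_const_smul g).measurable.aemeasurable = μ} := by
    ext μ
    simp only [Set.mem_ofPred_eq, Set.mem_iInter, InvProb]
    refine ⟨fun h g => Subtype.ext (h.2 g), fun h => ⟨inferInstance, fun g => ?_⟩⟩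
    exact congrArg Subtype.val (h g)
  rw [this]
  exact isClosed_iInter fun g => isClosed_eq
    (ProbabilityMeasure.continuous_map (continuous_const_smul g)) continuous_id

theorem exists_forall_invProb_thickening_lt [MetricSpace X] [CompactSpace X] [MeasurableSpace X]
    [BorelSpace X] [ContinuousConstSMul G X] {R : Set X} (hR : IsClosed R) {c : ENNReal}
    (h : ∀ μ : Measure X, InvProb G X μ → μ R < c) :
    ∃ δ : ℝ, 0 < δ ∧ ∀ μ : Measure X, InvProb G X μ → μ (Metric.thickening δ R) < c := by
  by_contra! hno
  obtain ⟨u, hu_anti, hu_pos, hu_lim⟩ := exists_seq_strictAnti_tendsto (0 : ℝ)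
  let T : ℕ → Set (ProbabilityMeasure X) := fun n =>
    {μ | InvProb G X μ} ∩ {μ | c ≤ (μ : Measure X) (Metric.cthickening (u n) R)}
  have hTc : ∀ n, IsClosed (T n) := fun n =>
    isClosed_setOf_invProb.inter
      (isClosed_setOf_le_probabilityMeasure_apply Metric.isClosed_cthickening c)
  have hne : (⋂ n, T n).Nonempty := by
    refine IsCompact.nonempty_iInter_of_sequence_nonempty_isCompact_isClosed T ?_ ?_
      (hTc 0).isCompact hTc
    · intro n μ hμ
      refine ⟨hμ.1, hμ.2.trans (measure_mono (Metric.cthickening_mono ?_ R))⟩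
      exact (hu_anti (Nat.lt_succ_self n)).le
    · intro n
      obtain ⟨μ, hμ, hc⟩ := hno (u n) (hu_pos n)
      exact ⟨⟨μ, hμ.1⟩, hμ, hc.trans (measure_mono (Metric.thickening_subset_cthickening _ _))⟩
  obtain ⟨μ, hμ⟩ := hne
  rw [Set.mem_iInter] at hμ
  have hlim : Filter.Tendsto (fun n => (μ : Measure X) (Metric.cthickening (u n) R)) Filter.atTop
      (nhds ((μ : Measure X) R)) :=
    (tendsto_measure_cthickening_of_isClosed
      ⟨1, one_pos, measure_ne_top _ _⟩ hR).comp hu_lim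
  exact (h μ (hμ 0).1).not_ge (ge_of_tendsto' hlim fun n => (hμ n).2)

theorem Paper.InvProb.measure_smul [TopologicalSpace X] [MeasurableSpace X] [BorelSpace X]
    [ContinuousConstSMul G X] {μ : Measure X} (hμ : InvProb G X μ) (g : G) {B : Set X}
    (hB : IsOpen B) : μ (g • B) = μ B := by
  conv_lhs => rw [← hμ.2 g]
  rw [Measure.map_apply (continuous_const_smul g).measurable (hB.smul g).measurableSet]
  congr 1
  ext x
  simp

theorem isOpen_castleUnion [TopologicalSpace X] [ContinuousConstSMul G X] {n : ℕ}
    (S : Fin n → Finset G) {B : Fin n → Set X} (hB : ∀ i, IsOpen (B i)) :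
    IsOpen (CastleUnion G X S B) :=
  isOpen_iUnion fun i => isOpen_biUnion fun s _ => (hB i).smul s

theorem Paper.InvProb.measure_castleUnion_le [TopologicalSpace X] [MeasurableSpace X]
    [BorelSpace X] [ContinuousConstSMul G X] {μ : Measure X} (hμ : InvProb G X μ) {n : ℕ}
    (S : Fin n → Finset G) {B : Fin n → Set X} (hB : ∀ i, IsOpen (B i)) :
    μ (CastleUnion G X S B) ≤ ∑ i, (S i).card * μ (B i) := by
  refine (measure_iUnion_fintype_le _ _).trans (Finset.sum_le_sum fun i _ => ?_)
  refine (measure_biUnion_finset_le _ _).trans_eq ?_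
  rw [Finset.sum_congr rfl fun s _ => hμ.measure_smul s (hB i), Finset.sum_const, nsmul_eq_mul]

theorem Paper.InvProb.measure_castleUnion [TopologicalSpace X] [MeasurableSpace X]
    [BorelSpace X] [ContinuousConstSMul G X] {μ : Measure X} (hμ : InvProb G X μ) {n : ℕ}
    {S : Fin n → Finset G} {B : Fin n → Set X} (hS : IsCastle G X S B)
    (hB : ∀ i, IsOpen (B i)) :
    μ (CastleUnion G X S B) = ∑ i, (S i).card * μ (B i) := by
  unfold CastleUnion
  rw [measure_iUnion, tsum_fintype]
  · refine Finset.sum_congr rfl fun i _ => ?_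
    rw [measure_biUnion_finset]
    · rw [Finset.sum_congr rfl fun s _ => hμ.measure_smul s (hB i), Finset.sum_const,
        nsmul_eq_mul]
    · exact fun s hs t ht hst => hS i i s hs t ht (by simpa using hst)
    · exact fun s _ => ((hB i).smul s).measurableSet
  · intro i j hij
    simp only [Function.onFun, Set.disjoint_iUnion_left, Set.disjoint_iUnion_right]
    exact fun t ht s hs => hS i j _ ‹_› _ ‹_› (by simp [hij])
  · exact fun i => (isOpen_biUnion fun s _ => (hB i).smul s).measurableSet

theorem Paper.IsCastle.subset {n : ℕ} {S S' : Fin n → Finset G} {B : Fin n → Set X}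
    (h : IsCastle G X S B) (hS : ∀ i, S' i ⊆ S i) : IsCastle G X S' B :=
  fun i j s hs t ht => h i j s (hS i hs) t (hS j ht)

/-- If the shapes `S' i` fill a proportion at least `1 / N` of the shapes `S i` and the castle
with shapes `S` misses less than `1 / (N + 1)` in measure, then the castle with shapes `S'` has
measure more than `1 / (N + 1)`. -/
theorem Paper.InvProb.lt_measure_castleUnion [TopologicalSpace X] [MeasurableSpace X]
    [BorelSpace X] [ContinuousConstSMul G X] {μ : Measure X} (hμ : InvProb G X μ) {n N : ℕ}
    {S S' : Fin n → Finset G} {B : Fin n → Set X} (hS' : IsCastle G X S' B)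
    (hB : ∀ i, IsOpen (B i)) (hcard : ∀ i, (S i).card ≤ N * (S' i).card)
    (hR : μ (Set.univ \ CastleUnion G X S B) < (N + 1 : ENNReal)⁻¹) :
    (N + 1 : ENNReal)⁻¹ < μ (CastleUnion G X S' B) := by
  have := hμ.1
  have hle : μ (CastleUnion G X S B) ≤ N * μ (CastleUnion G X S' B) := by
    rw [hμ.measure_castleUnion hS' hB, Finset.mul_sum]
    refine (hμ.measure_castleUnion_le S hB).trans (Finset.sum_le_sum fun i _ => ?_)
    rw [← mul_assoc]
    gcongr
    exact_mod_cast hcard i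
  have hone : (1 : ENNReal) ≤ N * μ (CastleUnion G X S' B) +
      μ (Set.univ \ CastleUnion G X S B) := by
    rw [← measure_univ (μ := μ)]
    refine (measure_mono fun x _ => ?_).trans
      ((measure_union_le (CastleUnion G X S B) (Set.univ \ CastleUnion G X S B)).trans
        (by gcongr))
    simp
  by_contra! hlt
  refine hone.not_gt ?_
  have hN : ((N : ENNReal) + 1) ≠ 0 := by simp
  have hN' : ((N : ENNReal) + 1) ≠ ⊤ := by finiteness
  calc N * μ (CastleUnion G X S' B) + μ (Set.univ \ CastleUnion G X S B)
      < N * (N + 1 : ENNReal)⁻¹ + (N + 1 : ENNReal)⁻¹ := by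
        refine ENNReal.add_lt_add_of_le_of_lt (by finiteness) (by gcongr) hR
    _ = (N + 1) * (N + 1 : ENNReal)⁻¹ := by ring
    _ = 1 := ENNReal.mul_inv_cancel hN hN'

end Invariant

theorem almostFinite_of_almostFiniteInMeasure_of_dynComparison
    (G : Type*) [Group G] [Countable G] [Infinite G]
    (X : Type*) [MetricSpace X] [CompactSpace X] [Infinite X]
    [MeasurableSpace X] [BorelSpace X]
    [MulAction G X] [ContinuousConstSMul G X]
    (ham : FolnerAmenable G)
    (h1 : AlmostFiniteInMeasure G X) (h2 : DynComparison G X) :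
    AlmostFinite G X := by
  intro K m hm ε hε
  obtain ⟨L, hKL, hL⟩ := Infinite.exists_superset_card_eq K (K.card + 2 * m) (by omega)
  let c : ℝ := ((2 * m : ℕ) + 1 : ℝ)⁻¹
  have hc : 0 < c := by positivity
  have hc1 : c ≤ 1 := inv_le_one_of_one_le₀ (by simp)
  have hcE : ENNReal.ofReal c = ((2 * m : ℕ) + 1 : ENNReal)⁻¹ := by
    rw [ENNReal.ofReal_inv_of_pos (by positivity), ENNReal.ofReal_add (by positivity) one_pos.le,
      ENNReal.ofReal_natCast, ENNReal.ofReal_one]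
  obtain ⟨n, S, B, hS, hB, hF, hdiam, hsup⟩ := h1 L (min ε c) (lt_min hε hc)
  refine ⟨n, S, B, hS, hB, fun i => (hF i).mono hKL (min_le_left _ _),
    fun i s hs => (hdiam i s hs).trans_le (min_le_left _ _), ?_⟩
  have hScard : ∀ i, m < (S i).card := fun i => by
    have := (hF i).card_lt ((min_le_right _ _).trans hc1)
    omega
  choose S' hS'sub hS'card using fun i =>
    Finset.exists_subset_card_eq (s := S i) (n := ((S i).card - 1) / m)
      ((Nat.div_le_self _ _).trans (Nat.sub_le _ _))
  have hcard : ∀ i, (S i).card ≤ 2 * m * (S' i).card := fun i => by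
    have hpos : 1 ≤ (S' i).card := by
      rw [hS'card, Nat.one_le_div_iff hm]
      have := hScard i
      omega
    have hlt : (S i).card - 1 < m * (S' i).card + m := by
      rw [hS'card]
      exact Nat.lt_mul_div_succ _ hm
    nlinarith [Nat.mul_le_mul_left m hpos, Nat.sub_add_cancel ((Nat.zero_le m).trans_lt (hScard i))]
  refine ⟨S', fun i => ⟨hS'sub i, ?_⟩, ?_⟩
  · rw [lt_div_iff₀ (by positivity)]
    have hle : (S' i).card * m ≤ (S i).card - 1 := by
      rw [hS'card]
      exact Nat.div_mul_le_self _ _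
    have hlt := hScard i
    exact_mod_cast (show (S' i).card * m < (S i).card by omega)
  have hRclosed : IsClosed (Set.univ \ CastleUnion G X S B) :=
    isClosed_univ.sdiff (isOpen_castleUnion S hB)
  have hR : ∀ μ : Measure X, InvProb G X μ →
      μ (Set.univ \ CastleUnion G X S B) < ((2 * m : ℕ) + 1 : ENNReal)⁻¹ := fun μ hμ =>
    ((le_iSup (fun ν : {ν : Measure X // InvProb G X ν} =>
      (ν : Measure X) (Set.univ \ CastleUnion G X S B)) ⟨μ, hμ⟩).trans_lt hsup).trans_le
      ((ENNReal.ofReal_le_ofReal (min_le_right _ _)).trans_eq hcE)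
  have hO : ∀ μ : Measure X, InvProb G X μ →
      ((2 * m : ℕ) + 1 : ENNReal)⁻¹ < μ (CastleUnion G X S' B) := fun μ hμ =>
    hμ.lt_measure_castleUnion (hS.subset hS'sub) hB hcard (hR μ hμ)
  obtain ⟨δ, hδ, hU⟩ := exists_forall_invProb_thickening_lt hRclosed hR
  rcases (Set.univ \ CastleUnion G X S B).eq_empty_or_nonempty with hempty | hne
  · rw [hempty]
    exact ⟨0, Fin.elim0, Fin.elim0, fun k => k.elim0, Set.empty_subset _, fun k => k.elim0,
      fun k => k.elim0⟩
  obtain ⟨μ, hμ⟩ := h2.exists_invProb ham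
  exact h2 _ _ Metric.isOpen_thickening (isOpen_castleUnion S' hB)
    (hne.mono (Metric.self_subset_thickening hδ _))
    (nonempty_of_measure_ne_zero (bot_le.trans_lt (hO μ hμ)).ne')
    (fun ν hν => (hU ν hν).trans (hO ν hν)) _ hRclosed (Metric.self_subset_thickening hδ _)
end

section
/- Let Γ be a countably infinite amenable group acting continuously on an infinite compact metrizable space X. If the action is almost finite, then it is almost finite in measure and has dynamical comparison. -/
open scoped Pointwise
open MeasureTheory

namespace Paper

section Subordination

variable {G X : Type*} [Group G] [TopologicalSpace X] [MulAction G X]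

theorem subord_of_fintype {ι : Type*} [Fintype ι] {C O : Set X} (V : ι → Set X) (g : ι → G)
    (hV : ∀ k, IsOpen (V k)) (hC : C ⊆ ⋃ k, V k) (hO : ∀ k, g k • V k ⊆ O)
    (hd : Pairwise fun k l => Disjoint (g k • V k) (g l • V l)) : Subord G X C O := by
  let e := Fintype.equivFin ι
  refine ⟨Fintype.card ι, fun k => V (e.symm k), fun k => g (e.symm k), fun k => hV _, ?_,
    fun k => hO _, fun k l hkl => hd (e.symm.injective.ne hkl)⟩
  rw [e.symm.surjective.iUnion_comp V]
  exact hC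

theorem subord_of_castle [ContinuousConstSMul G X] {C O : Set X} {n : ℕ}
    {S S' : Fin n → Finset G} {B : Fin n → Set X} (hcastle : IsCastle G X S B)
    (hB : ∀ i, IsOpen (B i)) (a b : Fin n → Finset G) (hb : ∀ i, b i ⊆ S i)
    (ha : ∀ i, ∀ s ∈ S i, ¬ Disjoint (s • B i) C → s ∈ a i)
    (hbO : ∀ i, ∀ s ∈ b i, s • B i ⊆ O)
    (hcard : ∀ i, (a i).card + (S' i).card ≤ (b i).card)
    (hrem : Subord G X (Set.univ \ CastleUnion G X S B) (CastleUnion G X S' B)) :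
    Subord G X C O := by
  classical
  obtain ⟨p, V, g, hVo, hVc, hVO, hVd⟩ := hrem
  have hemb (i : Fin n) : Nonempty (a i ⊕ S' i ↪ b i) :=
    Function.Embedding.nonempty_of_card_le (by simpa using hcard i)
  let φ (i : Fin n) : a i ⊕ S' i ↪ b i := (hemb i).some
  let W : (Σ i, a i ⊕ (S' i × Fin p)) → Set X
    | ⟨i, .inl s⟩ => (s : G) • B i
    | ⟨i, .inr (s, k)⟩ => V k ∩ ((g k)⁻¹ * (s : G)) • B i
  let h : (Σ i, a i ⊕ (S' i × Fin p)) → G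
    | ⟨i, .inl s⟩ => (φ i (.inl s) : G) * (s : G)⁻¹
    | ⟨i, .inr (s, k)⟩ => (φ i (.inr s) : G) * (s : G)⁻¹ * g k
  let level : (Σ i, a i ⊕ (S' i × Fin p)) → G
    | ⟨i, .inl s⟩ => φ i (.inl s)
    | ⟨i, .inr (s, _)⟩ => φ i (.inr s)
  have hlevel (j) : level j ∈ b j.1 := by
    rcases j with ⟨i, s | q⟩
    · exact (φ i (.inl s)).2
    · exact (φ i (.inr q.1)).2
  have hsub (j) : h j • W j ⊆ level j • B j.1 := by
    rcases j with ⟨i, s | q⟩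
    · simp [h, W, level, smul_smul]
    · change (_ * _ * g q.2) • (V q.2 ∩ ((g q.2)⁻¹ * (q.1 : G)) • B i) ⊆ (φ i (.inr q.1) : G) • B i
      refine (Set.smul_set_mono Set.inter_subset_right).trans ?_
      rw [smul_smul]
      simp [mul_assoc]
  refine subord_of_fintype W h ?_ ?_ ?_ ?_
  · rintro ⟨i, s | q⟩
    · exact (hB i).smul _
    · exact (hVo _).inter ((hB i).smul _)
  · intro x hx
    by_cases hxc : x ∈ CastleUnion G X S B
    · simp only [CastleUnion, Set.mem_iUnion] at hxc
      obtain ⟨i, s, hs, hxs⟩ := hxc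
      have : s ∈ a i := ha i s hs (Set.not_disjoint_iff.2 ⟨x, hxs, hx⟩)
      exact Set.mem_iUnion.2 ⟨⟨i, .inl ⟨s, this⟩⟩, hxs⟩
    · obtain ⟨k, hk⟩ := Set.mem_iUnion.1 (hVc ⟨trivial, hxc⟩)
      have := hVO k (Set.smul_mem_smul_set hk)
      simp only [CastleUnion, Set.mem_iUnion] at this
      obtain ⟨i, s, hs, hxs⟩ := this
      refine Set.mem_iUnion.2 ⟨⟨i, .inr (⟨s, hs⟩, k)⟩, hk, ?_⟩
      change x ∈ ((g k)⁻¹ * s) • B i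
      rwa [mul_smul, Set.mem_inv_smul_set_iff]
  · exact fun j => (hsub j).trans (hbO _ _ (hlevel j))
  · intro j k hjk
    by_cases hne : (j.1, level j) = (k.1, level k)
    · rcases j with ⟨i, s | ⟨s, u⟩⟩ <;> rcases k with ⟨i', t | ⟨t, v⟩⟩ <;>
        obtain ⟨rfl, hl⟩ := Prod.ext_iff.1 hne <;>
        have hst := (φ i).injective (Subtype.ext hl)
      · cases hst
        exact absurd rfl hjk
      · cases hst
      · cases hst
      · cases hst
        have huv : u ≠ v := by
          rintro rfl
          exact hjk rfl
        have hmono (w : Fin p) : h ⟨i, .inr (s, w)⟩ • W ⟨i, .inr (s, w)⟩ ⊆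
            ((φ i (.inr s) : G) * (s : G)⁻¹) • g w • V w := by
          rw [smul_smul]
          exact Set.smul_set_mono Set.inter_subset_left
        exact (Set.disjoint_smul_set.2 (hVd huv)).mono (hmono u) (hmono v)
    · exact (hcastle _ _ _ (hb _ (hlevel j)) _ (hb _ (hlevel k)) hne).mono (hsub j) (hsub k)

end Subordination

section Folner

variable {G : Type*} [Group G]

theorem IsFolner.card_pos {K S : Finset G} {ε : ℝ} (h : IsFolner K S ε) : 0 < S.card := by
  by_contra! h0
  have : S = ∅ := by simpa using h0
  subst this
  simp [IsFolner] at h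

theorem IsFolner.mono_s1 {K S : Finset G} {ε ε' : ℝ} (h : IsFolner K S ε) (hε : ε ≤ ε') :
    IsFolner K S ε' :=
  lt_of_lt_of_le h (by gcongr)

theorem IsFolner.abs_sum_mul_left_sub_sum_le {K S : Finset G} {ε : ℝ} (h : IsFolner K S ε)
    {g : G} (hg : g ∈ K) {f : G → ℝ} {M : ℝ} (hf : ∀ s, |f s| ≤ M) :
    |∑ s ∈ S, f (g * s) - ∑ s ∈ S, f s| ≤ 2 * M * ε * S.card := by
  classical
  have hM : 0 ≤ M := (abs_nonneg _).trans (hf 1)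
  set T := S.image (g * ·)
  have hTc : T.card = S.card := Finset.card_image_of_injective _ (mul_right_injective g)
  have hsum : ∑ s ∈ S, f (g * s) = ∑ s ∈ T, f s :=
    (Finset.sum_image fun _ _ _ _ h => mul_right_injective g h).symm
  have hb (A : Finset G) : |∑ s ∈ A, f s| ≤ A.card * M := by
    refine (Finset.abs_sum_le_sum_abs _ _).trans ?_
    simpa using Finset.sum_le_card_nsmul A _ M fun s _ => hf s
  have hd : ((T \ S).card : ℝ) ≤ ε * S.card := by
    refine le_trans ?_ (le_of_lt h)
    have : T \ S ⊆ (K * S) \ S := by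
      refine Finset.sdiff_subset_sdiff ?_ le_rfl
      intro t ht
      obtain ⟨s, hs, rfl⟩ := Finset.mem_image.1 ht
      exact Finset.mul_mem_mul hg hs
    convert (Nat.cast_le (α := ℝ)).2 (Finset.card_le_card this)
  have hd' : (S \ T).card = (T \ S).card := Finset.card_sdiff_comm hTc.symm
  rw [hsum, ← Finset.sum_sdiff_sub_sum_sdiff]
  calc |∑ s ∈ T \ S, f s - ∑ s ∈ S \ T, f s|
      ≤ |∑ s ∈ T \ S, f s| + |∑ s ∈ S \ T, f s| := abs_sub _ _
    _ ≤ (T \ S).card * M + (S \ T).card * M := add_le_add (hb _) (hb _)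
    _ = 2 * M * (T \ S).card := by rw [hd']; ring
    _ ≤ 2 * M * (ε * S.card) := by gcongr
    _ = 2 * M * ε * S.card := by ring

end Folner

section Empirical

variable {G X : Type*} [Group G] [MulAction G X] [MeasurableSpace X]

/-- The uniform average of the point masses at `s • x`, for `s` in a finite set `S`. -/
noncomputable def orbitAverage (S : Finset G) (x : X) : Measure X :=
  (S.card : ENNReal)⁻¹ • ∑ s ∈ S, Measure.dirac (s • x)

theorem isProbabilityMeasure_orbitAverage {S : Finset G} (hS : 0 < S.card) (x : X) :
    IsProbabilityMeasure (orbitAverage S x) := by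
  constructor
  have h0 : (S.card : ENNReal) ≠ 0 := by exact_mod_cast hS.ne'
  simp [orbitAverage, ENNReal.inv_mul_cancel h0]

theorem integral_orbitAverage [TopologicalSpace X] [OpensMeasurableSpace X] (S : Finset G) (x : X)
    (f : BoundedContinuousFunction X ℝ) :
    ∫ y, f y ∂(orbitAverage S x) = (S.card : ℝ)⁻¹ * ∑ s ∈ S, f (s • x) := by
  rw [orbitAverage, integral_smul_measure, integral_finsetSum_measure]
  · simp [integral_dirac' _ _ f.continuous.stronglyMeasurable]
  · exact fun s _ => f.integrable _

open scoped Classical in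
theorem orbitAverage_apply (S : Finset G) (x : X) {F : Set X} (hF : MeasurableSet F) :
    orbitAverage S x F = (S.card : ENNReal)⁻¹ * (S.filter fun s => s • x ∈ F).card := by
  simp [orbitAverage, Measure.dirac_apply' _ hF, Set.indicator_apply]

end Empirical

section Compactness

variable {G X : Type*} [Group G] [MetricSpace X] [MeasurableSpace X] [BorelSpace X]
  [MulAction G X] [ContinuousConstSMul G X]

open Filter Topology

theorem invProb_of_tendsto_orbitAverage {ι : Type*} {L : Filter ι} [L.NeBot]
    {K S : ι → Finset G} {ε : ι → ℝ} {x : ι → X} {ν : ι → ProbabilityMeasure X}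
    {μ : ProbabilityMeasure X} (hS : ∀ p, IsFolner (K p) (S p) (ε p))
    (hK : ∀ g : G, ∀ᶠ p in L, g ∈ K p) (hε : Tendsto ε L (𝓝 0))
    (hν : ∀ p, (ν p : Measure X) = orbitAverage (S p) (x p)) (hμ : Tendsto ν L (𝓝 μ)) :
    InvProb G X (μ : Measure X) := by
  rw [ProbabilityMeasure.tendsto_iff_forall_integral_tendsto] at hμ
  refine ⟨inferInstance, fun g => ?_⟩
  have hg : Continuous fun y : X => g • y := continuous_const_smul g
  have := Measure.isProbabilityMeasure_map (μ := (μ : Measure X)) hg.aemeasurable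
  refine ext_of_forall_integral_eq_of_IsFiniteMeasure fun f => ?_
  rw [integral_map hg.aemeasurable f.continuous.aestronglyMeasurable]
  let f' : BoundedContinuousFunction X ℝ := f.compContinuous ⟨_, hg⟩
  have hdiff := (hμ f').sub (hμ f)
  have hzero : Tendsto (fun p => ∫ y, f' y ∂(ν p : Measure X) - ∫ y, f y ∂(ν p : Measure X)) L
      (𝓝 0) := by
    have hlim : Tendsto (fun p => 2 * ‖f‖ * ε p) L (𝓝 0) := by
      simpa using hε.const_mul (2 * ‖f‖)
    refine squeeze_zero_norm' ?_ hlim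
    filter_upwards [hK g] with p hp
    have hc : (0 : ℝ) < (S p).card := by exact_mod_cast (hS p).card_pos
    have hle := (hS p).abs_sum_mul_left_sub_sum_le hp (f := fun s => f (s • x p)) (M := ‖f‖)
      fun s => f.norm_coe_le_norm _
    rw [hν, integral_orbitAverage, integral_orbitAverage, ← mul_sub, norm_mul, norm_inv,
      Real.norm_natCast, inv_mul_le_iff₀ hc, mul_comm ((S p).card : ℝ)]
    simpa [f', mul_smul] using hle
  exact sub_eq_zero.1 (tendsto_nhds_unique hdiff hzero)

open scoped Classical in
theorem exists_folner_visit_bound [CompactSpace X] {C D : Set X} (hC : IsClosed C) (hD : IsClosed D)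
    (hCD : ∀ μ : Measure X, InvProb G X μ → μ C + μ D < 1) :
    ∃ (K : Finset G) (m : ℕ), ∀ S : Finset G, IsFolner K S (1 / ((m : ℝ) + 1)) → ∀ x : X,
      ((S.filter fun s => s • x ∈ Metric.cthickening (1 / ((m : ℝ) + 1)) C).card : ℝ) +
        (S.filter fun s => s • x ∈ Metric.cthickening (1 / ((m : ℝ) + 1)) D).card ≤
          (1 - 1 / ((m : ℝ) + 1)) * S.card := by
  by_contra! hcon
  choose S hS x hx using fun p : Finset G × ℕ => hcon p.1 p.2
  let ε : Finset G × ℕ → ℝ := fun p => 1 / ((p.2 : ℝ) + 1)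
  let ν : Finset G × ℕ → ProbabilityMeasure X := fun p =>
    ⟨orbitAverage (S p) (x p), isProbabilityMeasure_orbitAverage (hS p).card_pos _⟩
  let L : Ultrafilter (Finset G × ℕ) := Ultrafilter.of atTop
  have hL : (L : Filter (Finset G × ℕ)) ≤ atTop := Ultrafilter.of_le _
  obtain ⟨μ, -, hμ⟩ := isCompact_univ.ultrafilter_le_nhds (L.map ν) (by simp)
  replace hμ : Tendsto ν L (𝓝 μ) := hμ
  have hε : Tendsto ε L (𝓝 0) := by
    have h2 : Tendsto (Prod.snd : Finset G × ℕ → ℕ) L atTop := by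
      refine Tendsto.mono_left ?_ hL
      rw [← prod_atTop_atTop_eq]
      exact tendsto_snd
    exact tendsto_one_div_add_atTop_nhds_zero_nat.comp h2
  have hK (g : G) : ∀ᶠ p : Finset G × ℕ in L, g ∈ p.1 := by
    filter_upwards [hL (eventually_ge_atTop ({g}, 0))] with p hp
    exact hp.1 (Finset.mem_singleton_self g)
  have hinv : InvProb G X (μ : Measure X) :=
    invProb_of_tendsto_orbitAverage hS hK hε (fun _ => rfl) hμ
  have hthick : Tendsto (fun δ => (μ : Measure X) (Metric.cthickening δ C) +
      (μ : Measure X) (Metric.cthickening δ D)) (𝓝[>] 0)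
      (𝓝 ((μ : Measure X) C + (μ : Measure X) D)) :=
    ((tendsto_measure_cthickening_of_isClosed ⟨1, one_pos, measure_ne_top _ _⟩ hC).add
      (tendsto_measure_cthickening_of_isClosed ⟨1, one_pos, measure_ne_top _ _⟩ hD)).mono_left
        nhdsWithin_le_nhds
  obtain ⟨δ, hδ, hδ0⟩ :=
    ((hthick.eventually_lt_const (hCD _ hinv)).and self_mem_nhdsWithin).exists
  obtain ⟨c, hc, d, hd, hcd⟩ := ENNReal.exists_add_lt_of_add_lt hδ
  have hcC : ∀ᶠ p in (L : Filter (Finset G × ℕ)), (ν p : Measure X) (Metric.cthickening δ C) < c :=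
    eventually_lt_of_limsup_lt (lt_of_le_of_lt
      (ProbabilityMeasure.limsup_measure_closed_le_of_tendsto hμ Metric.isClosed_cthickening) hc)
  have hdD : ∀ᶠ p in (L : Filter (Finset G × ℕ)), (ν p : Measure X) (Metric.cthickening δ D) < d :=
    eventually_lt_of_limsup_lt (lt_of_le_of_lt
      (ProbabilityMeasure.limsup_measure_closed_le_of_tendsto hμ Metric.isClosed_cthickening) hd)
  generalize hr : c + d = r at hcd
  have hr0 : r ≠ ⊤ := (hcd.trans ENNReal.one_lt_top).ne
  have hrr : r.toReal < 1 := by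
    simpa using (ENNReal.toReal_lt_toReal hr0 ENNReal.one_ne_top).2 hcd
  have hsmall : ∀ᶠ p in (L : Filter (Finset G × ℕ)), ε p < min δ (1 - r.toReal) :=
    hε.eventually_lt_const (lt_min hδ0 (sub_pos.2 hrr))
  obtain ⟨p, ⟨hpC, hpD⟩, hpε⟩ := ((hcC.and hdD).and hsmall).exists
  have hc : (0 : ℝ) < (S p).card := by exact_mod_cast (hS p).card_pos
  have hmono (E : Set X) :
      (((S p).filter fun s => s • x p ∈ Metric.cthickening (1 / ((p.2 : ℝ) + 1)) E).card : ℝ) ≤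
        ((S p).filter fun s => s • x p ∈ Metric.cthickening δ E).card := by
    refine Nat.cast_le.2 (Finset.card_le_card (Finset.monotone_filter_right _ fun s _ hs => ?_))
    exact Metric.cthickening_mono (hpε.le.trans (min_le_left _ _)) _ hs
  have hp' : (S p).card * r.toReal >
      (((S p).filter fun s => s • x p ∈ Metric.cthickening δ C).card : ℝ) +
        ((S p).filter fun s => s • x p ∈ Metric.cthickening δ D).card := by
    have hlt : (orbitAverage (S p) (x p) (Metric.cthickening δ C) +
        orbitAverage (S p) (x p) (Metric.cthickening δ D)) < r := hr ▸ ENNReal.add_lt_add hpC hpD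
    rw [orbitAverage_apply _ _ Metric.isClosed_cthickening.measurableSet,
      orbitAverage_apply _ _ Metric.isClosed_cthickening.measurableSet, ← mul_add,
      ← ENNReal.toReal_lt_toReal (ne_top_of_lt hlt) hr0, ENNReal.toReal_mul, ENNReal.toReal_inv,
      ENNReal.toReal_natCast, inv_mul_lt_iff₀ hc, ← Nat.cast_add, ENNReal.toReal_natCast] at hlt
    exact_mod_cast hlt
  have h1 : r.toReal < 1 - 1 / ((p.2 : ℝ) + 1) := by
    have := hpε.trans_le (min_le_right _ _)
    simp only [ε] at this
    linarith
  have := mul_lt_mul_of_pos_right h1 hc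
  linarith [hx p, hmono C, hmono D]

end Compactness

section AlmostFinite

variable {G X : Type*} [Group G] [MetricSpace X] [MeasurableSpace X] [BorelSpace X]
  [MulAction G X] [ContinuousConstSMul G X]

theorem InvProb.measure_smul_s1 {μ : Measure X} (hμ : InvProb G X μ) (g : G) (A : Set X) :
    μ (g • A) = μ A := by
  have hinv : Measure.map (Homeomorph.smul g : X ≃ₜ X).toMeasurableEquiv μ = μ := hμ.2 g
  conv_lhs => rw [← hinv]
  rw [MeasurableEquiv.map_apply]
  congr 1
  ext y
  simp

theorem InvProb.measure_le_of_subord {μ : Measure X} (hμ : InvProb G X μ) {C O : Set X}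
    (h : Subord G X C O) : μ C ≤ μ O := by
  obtain ⟨p, V, g, hVo, hVc, hVO, hVd⟩ := h
  calc μ C ≤ ∑ k, μ (V k) := (measure_mono hVc).trans (measure_iUnion_fintype_le _ _)
    _ = ∑ k, μ (g k • V k) := by simp [hμ.measure_smul_s1]
    _ = μ (⋃ k, g k • V k) := by
      rw [measure_iUnion hVd fun k => ((hVo k).smul _).measurableSet, tsum_fintype]
    _ ≤ μ O := measure_mono (Set.iUnion_subset hVO)

theorem InvProb.measure_castleUnion_le_s1 {μ : Measure X} (hμ : InvProb G X μ) {n : ℕ}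
    {S : Fin n → Finset G} {B : Fin n → Set X} :
    μ (CastleUnion G X S B) ≤ ∑ i, (S i).card * μ (B i) := by
  refine (measure_iUnion_fintype_le _ _).trans (Finset.sum_le_sum fun i _ => ?_)
  refine (measure_biUnion_finset_le _ _).trans ?_
  simp [hμ.measure_smul_s1]

theorem InvProb.measure_castleUnion_s1 {μ : Measure X} (hμ : InvProb G X μ) {n : ℕ}
    {S : Fin n → Finset G} {B : Fin n → Set X} (hcastle : IsCastle G X S B)
    (hB : ∀ i, IsOpen (B i)) :
    μ (CastleUnion G X S B) = ∑ i, (S i).card * μ (B i) := by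
  rw [CastleUnion, measure_iUnion, tsum_fintype]
  · refine Finset.sum_congr rfl fun i _ => ?_
    rw [measure_biUnion_finset]
    · simp [hμ.measure_smul_s1]
    · intro s hs t ht hst
      exact hcastle i i s hs t ht (by simpa using hst)
    · exact fun s _ => ((hB i).smul s).measurableSet
  · intro i j hij
    simp only [Function.onFun, Set.disjoint_iUnion_left, Set.disjoint_iUnion_right]
    exact fun t ht s hs => hcastle i j s hs t ht (by simp [hij])
  · exact fun i => MeasurableSet.biUnion (S i).countable_toSet
      fun s _ => ((hB i).smul s).measurableSet

theorem AlmostFinite.almostFiniteInMeasure (h : AlmostFinite G X) :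
    AlmostFiniteInMeasure G X := by
  intro K ε hε
  obtain ⟨m, hm⟩ := exists_nat_gt (1 / ε)
  have hm0 : (0 : ℝ) < m := (one_div_pos.2 hε).trans hm
  obtain ⟨n, S, B, hcastle, hB, hS, hdiam, S', hS', hrem⟩ := h K m (by exact_mod_cast hm0) ε hε
  refine ⟨n, S, B, hcastle, hB, hS, hdiam, ?_⟩
  have hlt : ENNReal.ofReal (1 / m) < ENNReal.ofReal ε := by
    rw [ENNReal.ofReal_lt_ofReal_iff hε]
    exact (one_div_lt hm0 hε).2 hm
  refine lt_of_le_of_lt (iSup_le fun ⟨μ, hμ⟩ => ?_) hlt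
  have := hμ.1
  calc μ (Set.univ \ CastleUnion G X S B) ≤ μ (CastleUnion G X S' B) :=
        hμ.measure_le_of_subord hrem
    _ ≤ ∑ i, (S' i).card * μ (B i) := hμ.measure_castleUnion_le_s1
    _ ≤ ∑ i, ENNReal.ofReal (1 / m) * ((S i).card * μ (B i)) := by
      refine Finset.sum_le_sum fun i _ => ?_
      rw [← mul_assoc]
      gcongr
      rw [← ENNReal.ofReal_natCast, ← ENNReal.ofReal_natCast,
        ← ENNReal.ofReal_mul (by positivity)]
      refine ENNReal.ofReal_le_ofReal ((hS' i).2.le.trans_eq ?_)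
      ring
    _ = ENNReal.ofReal (1 / m) * μ (CastleUnion G X S B) := by
      rw [hμ.measure_castleUnion_s1 hcastle hB, Finset.mul_sum]
    _ ≤ ENNReal.ofReal (1 / m) := mul_le_of_le_one_right' prob_le_one

theorem AlmostFinite.dynComparison [CompactSpace X] (h : AlmostFinite G X) : DynComparison G X := by
  classical
  intro U O _ hO _ _ hUO C hC hCU
  have hCD (μ : Measure X) (hμ : InvProb G X μ) : μ C + μ Oᶜ < 1 := by
    have := hμ.1
    calc μ C + μ Oᶜ < μ O + μ Oᶜ :=
          ENNReal.add_lt_add_right (measure_ne_top _ _) ((measure_mono hCU).trans_lt (hUO μ hμ))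
      _ = 1 := prob_add_prob_compl hO.measurableSet
  obtain ⟨K, m, hKm⟩ := exists_folner_visit_bound hC hO.isClosed_compl hCD
  obtain ⟨n, S, B, hcastle, hB, hS, hdiam, S', hS', hrem⟩ :=
    h K (m + 1) m.succ_pos (1 / ((m : ℝ) + 1)) (by positivity)
  refine subord_of_castle hcastle hB (fun i => (S i).filter fun s => ¬ Disjoint (s • B i) C)
    (fun i => (S i).filter fun s => s • B i ⊆ O) (fun i => Finset.filter_subset _ _)
    (fun i s hs hd => Finset.mem_filter.2 ⟨hs, hd⟩) (fun i s hs => (Finset.mem_filter.1 hs).2)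
    (fun i => ?_) hrem
  rcases (B i).eq_empty_or_nonempty with hBe | ⟨x, hx⟩
  · simpa [hBe] using Finset.card_le_card (hS' i).1
  have hmem (E : Set X) (s : G) (hs : s ∈ S i) (hE : ¬ Disjoint (s • B i) E) :
      s • x ∈ Metric.cthickening (1 / ((m : ℝ) + 1)) E := by
    obtain ⟨y, hy, hyE⟩ := Set.not_disjoint_iff.1 hE
    refine Metric.mem_cthickening_of_dist_le _ y _ _ hyE ?_
    exact (Metric.dist_le_diam_of_mem Metric.isBounded_of_compactSpace
      (Set.smul_mem_smul_set hx) hy).trans (hdiam i s hs).le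
  have hle (E : Set X) : (((S i).filter fun s => ¬ Disjoint (s • B i) E).card : ℝ) ≤
      ((S i).filter fun s => s • x ∈ Metric.cthickening (1 / ((m : ℝ) + 1)) E).card := by
    refine Nat.cast_le.2 (Finset.card_le_card fun s hs => ?_)
    rw [Finset.mem_filter] at hs ⊢
    exact ⟨hs.1, hmem E s hs.1 hs.2⟩
  have hcount := hKm (S i) (hS i) x
  have hsplit : (((S i).filter fun s => s • B i ⊆ O).card : ℝ) +
      ((S i).filter fun s => ¬ Disjoint (s • B i) Oᶜ).card = (S i).card := by
    simp only [Set.disjoint_compl_right_iff_subset]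
    exact_mod_cast Finset.card_filter_add_card_filter_not _
  have hS'i := (hS' i).2
  push_cast at hS'i
  rw [div_eq_mul_one_div] at hS'i
  rw [← Nat.cast_le (α := ℝ)]
  push_cast
  linarith [hle C, hle Oᶜ]

end AlmostFinite

end Paper

open Paper

theorem almostFiniteInMeasure_and_dynComparison_of_almostFinite
    (G : Type*) [Group G] [Countable G] [Infinite G]
    (X : Type*) [MetricSpace X] [CompactSpace X] [Infinite X]
    [MeasurableSpace X] [BorelSpace X]
    [MulAction G X] [ContinuousConstSMul G X]
    (ham : FolnerAmenable G)
    (h : AlmostFinite G X) :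
    AlmostFiniteInMeasure G X ∧ DynComparison G X :=
  ⟨h.almostFiniteInMeasure, h.dynComparison⟩
end

section
/- Let H be a normal subgroup of a group Γ with quotient homomorphism ρ: Γ → G = Γ/H. Let K ⊆ Γ be a nonempty finite set and ε > 0. Let S ⊆ G be a finite (ρ(K), ε/|K|)-Følner set, let S̃ ⊆ Γ be a transversal for S (that is, ρ restricted to S̃ is a bijection from S̃ onto S), and let F ≤ H be a finite subgroup with S̃⁻¹KS̃ ∩ H ⊆ F. Then the set A = S̃·F = {gf : g ∈ S̃, f ∈ F} is the disjoint union of the cosets gF (g ∈ S̃), has cardinality |A| = |S|·|F|, and satisfies |K·A \ A| < ε|A|. -/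
open scoped Pointwise
open MeasureTheory

open Paper

theorem isFolner_iff {G : Type*} [Group G] [DecidableEq G] (K S : Finset G) (ε : ℝ) :
    IsFolner K S ε ↔ (((K * S) \ S).card : ℝ) < ε * S.card := by
  unfold IsFolner
  convert Iff.rfl

theorem folner_lift_along_extension
    (Γ : Type*) [Group Γ] [DecidableEq Γ]
    (H : Subgroup Γ) [H.Normal] [DecidableEq (Γ ⧸ H)]
    (K : Finset Γ) (hK : K.Nonempty) (ε : ℝ) (hε : 0 < ε)
    (S : Finset (Γ ⧸ H))
    (hS : IsFolner (K.image (QuotientGroup.mk : Γ → Γ ⧸ H)) S (ε / (K.card : ℝ)))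
    (St : Finset Γ)
    (htrans : Set.BijOn (QuotientGroup.mk : Γ → Γ ⧸ H) (St : Set Γ) (S : Set (Γ ⧸ H)))
    (F : Subgroup Γ) (hFH : F ≤ H) (hFfin : (F : Set Γ).Finite)
    (hKF : ∀ g ∈ St, ∀ k ∈ K, ∀ g' ∈ St, g⁻¹ * k * g' ∈ H → g⁻¹ * k * g' ∈ F) :
    (St * hFfin.toFinset : Finset Γ) = St.biUnion (fun g => g • hFfin.toFinset) ∧
    (∀ g ∈ St, ∀ g' ∈ St, g ≠ g' →
      Disjoint (g • hFfin.toFinset : Finset Γ) (g' • hFfin.toFinset)) ∧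
    (St * hFfin.toFinset).card = S.card * hFfin.toFinset.card ∧
    IsFolner K (St * hFfin.toFinset) ε := by
  have hmemA : ∀ x, x ∈ St * hFfin.toFinset ↔ ∃ g ∈ St, ∃ f ∈ F, g * f = x := by
    intro x
    simp [Finset.mem_mul]
  have hunion : St * hFfin.toFinset = St.biUnion (fun g => g • hFfin.toFinset) := by
    ext x
    simp [hmemA]
  have hdisj : ∀ g ∈ St, ∀ g' ∈ St, g ≠ g' →
      Disjoint (g • hFfin.toFinset : Finset Γ) (g' • hFfin.toFinset) := by
    intro g hg g' hg' hne
    refine Finset.disjoint_left.2 fun x hx hx' => hne ?_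
    simp only [Finset.mem_smul_finset, Set.Finite.mem_toFinset, SetLike.mem_coe,
      smul_eq_mul] at hx hx'
    obtain ⟨f, hf, rfl⟩ := hx
    obtain ⟨f', hf', h⟩ := hx'
    refine htrans.injOn hg hg' ?_
    rw [← QuotientGroup.mk_mul_of_mem g (hFH hf), ← h, QuotientGroup.mk_mul_of_mem g' (hFH hf')]
  have hcardS : St.card = S.card :=
    Finset.card_bij (fun g _ => (g : Γ ⧸ H)) (fun _ hg => htrans.mapsTo hg)
      (fun _ h _ h' e => htrans.injOn h h' e)
      (fun b hb => by obtain ⟨a, ha, e⟩ := htrans.surjOn hb; exact ⟨a, ha, e⟩)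
  have hcard : (St * hFfin.toFinset).card = S.card * hFfin.toFinset.card := by
    rw [hunion, Finset.card_biUnion hdisj]
    simp [hcardS]
  refine ⟨hunion, hdisj, hcard, ?_⟩
  rw [isFolner_iff] at hS ⊢
  set B := (K.image (QuotientGroup.mk : Γ → Γ ⧸ H) * S) \ S
  let P := (K ×ˢ St).filter fun p => ((p.1 * p.2 : Γ) : Γ ⧸ H) ∉ S
  have hP : P.card ≤ K.card * B.card := by
    rw [← Finset.card_product]
    refine Finset.card_le_card_of_injOn (fun p => (p.1, ((p.1 * p.2 : Γ) : Γ ⧸ H))) ?_ ?_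
    · rintro ⟨k, g⟩ hp
      obtain ⟨hkg, hS'⟩ := Finset.mem_filter.1 (Finset.mem_coe.1 hp)
      obtain ⟨hk, hg⟩ := Finset.mem_product.1 hkg
      exact Finset.mem_product.2 ⟨hk, Finset.mem_sdiff.2
        ⟨Finset.mul_mem_mul (Finset.mem_image_of_mem _ hk) (htrans.mapsTo hg), hS'⟩⟩
    · rintro ⟨k, g⟩ hp ⟨k', g'⟩ hp' h
      have hg := (Finset.mem_product.1 (Finset.mem_filter.1 (Finset.mem_coe.1 hp)).1).2
      have hg' := (Finset.mem_product.1 (Finset.mem_filter.1 (Finset.mem_coe.1 hp')).1).2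
      obtain ⟨rfl, h⟩ := Prod.mk.inj h
      simp only [QuotientGroup.mk_mul] at h
      exact Prod.ext rfl (htrans.injOn hg hg' (mul_left_cancel h))
  have hsub : (K * (St * hFfin.toFinset)) \ (St * hFfin.toFinset) ⊆
      (P ×ˢ hFfin.toFinset).image fun q => q.1.1 * q.1.2 * q.2 := by
    intro x hx
    obtain ⟨hx, hxA⟩ := Finset.mem_sdiff.1 hx
    obtain ⟨k, hk, a, ha, rfl⟩ := Finset.mem_mul.1 hx
    obtain ⟨g, hg, f, hf, rfl⟩ := (hmemA a).1 ha
    refine Finset.mem_image.2 ⟨((k, g), f), Finset.mem_product.2 ⟨Finset.mem_filter.2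
      ⟨Finset.mem_product.2 ⟨hk, hg⟩, fun hmem => hxA ?_⟩, by simpa using hf⟩, mul_assoc k g f⟩
    obtain ⟨g₀, hg₀, e⟩ := htrans.surjOn hmem
    have hmemF := hKF g₀ hg₀ k hk g hg (by simpa [mul_assoc] using QuotientGroup.eq.1 e)
    exact (hmemA _).2 ⟨g₀, hg₀, _, F.mul_mem hmemF hf, by group⟩
  have hle : ((K * (St * hFfin.toFinset)) \ (St * hFfin.toFinset)).card ≤
      K.card * B.card * hFfin.toFinset.card := by
    calc _ ≤ (P ×ˢ hFfin.toFinset).card := (Finset.card_le_card hsub).trans Finset.card_image_le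
      _ ≤ _ := by rw [Finset.card_product]; gcongr
  have hKpos : (0 : ℝ) < K.card := by exact_mod_cast hK.card_pos
  have hFpos : (0 : ℝ) < hFfin.toFinset.card := by
    exact_mod_cast Finset.card_pos.2 ⟨1, by simp [F.one_mem]⟩
  calc (((K * (St * hFfin.toFinset)) \ (St * hFfin.toFinset)).card : ℝ)
      ≤ K.card * B.card * hFfin.toFinset.card := by exact_mod_cast hle
    _ < K.card * (ε / K.card * S.card) * hFfin.toFinset.card := by gcongr
    _ = ε * (St * hFfin.toFinset).card := by
      rw [hcard]
      push_cast
      field_simp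
end

section
/- Let Γ be a countable amenable group, H ⊴ Γ a normal subgroup, G = Γ/H with quotient homomorphism ρ: Γ → G. Let Γ act continuously on a compact metrizable space X and suppose the orbit space X/H is Hausdorff. If the Γ-action on X is essentially free, then the induced G-action β on X/H is essentially free. -/
open scoped Pointwise
open MeasureTheory

open Paper

open Filter Topology

section InvariantMean

variable {Γ : Type*}

/-- The average of a real function over a finite set. -/
noncomputable def finsetAverage (S : Finset Γ) (F : Γ → ℝ) : ℝ :=
  (∑ t ∈ S, F t) / S.card

theorem finsetAverage_mem_Icc {S : Finset Γ} (hS : S.Nonempty) {F : Γ → ℝ} {a b : ℝ}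
    (hF : ∀ t, F t ∈ Set.Icc a b) : finsetAverage S F ∈ Set.Icc a b := by
  have hc : (0 : ℝ) < S.card := by exact_mod_cast hS.card_pos
  constructor
  · rw [finsetAverage, le_div_iff₀ hc, mul_comm, ← nsmul_eq_mul]
    exact Finset.card_nsmul_le_sum _ _ _ fun t _ => (hF t).1
  · rw [finsetAverage, div_le_iff₀ hc, mul_comm, ← nsmul_eq_mul]
    exact Finset.sum_le_card_nsmul _ _ _ fun t _ => (hF t).2

variable [Group Γ]

theorem Paper.IsFolner.nonempty {K S : Finset Γ} {ε : ℝ} (h : IsFolner K S ε) : S.Nonempty := by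
  classical
  rw [Finset.nonempty_iff_ne_empty]
  rintro rfl
  simp [IsFolner] at h

theorem Paper.IsFolner.abs_finsetAverage_mul_left_sub_le {K S : Finset Γ} {ε : ℝ}
    (h : IsFolner K S ε) {s : Γ} (hs : s ∈ K) {F : Γ → ℝ} {C : ℝ} (hF : ∀ t, |F t| ≤ C) :
    |finsetAverage S (fun t => F (s * t)) - finsetAverage S F| ≤ 2 * ε * C := by
  classical
  have hc : (0 : ℝ) < S.card := by exact_mod_cast h.nonempty.card_pos
  have hC : 0 ≤ C := (abs_nonneg _).trans (hF 1)
  set T : Finset Γ := S.image (s * ·) with hT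
  have hTS : ∑ t ∈ S, F (s * t) = ∑ t ∈ T, F t := by
    rw [hT, Finset.sum_image fun a _ b _ hab => mul_left_cancel hab]
  have hcard : T.card = S.card := Finset.card_image_of_injective _ (mul_right_injective s)
  have hsub : ((T \ S).card : ℝ) ≤ ε * S.card := by
    have hle : (T \ S).card ≤ ((K * S) \ S).card := by
      refine Finset.card_le_card (Finset.sdiff_subset_sdiff ?_ subset_rfl)
      intro x hx
      obtain ⟨t, ht, rfl⟩ := Finset.mem_image.1 hx
      exact Finset.mul_mem_mul hs ht
    have h' : (((K * S) \ S).card : ℝ) < ε * S.card := by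
      unfold IsFolner at h
      convert h
    exact (Nat.cast_le.2 hle).trans h'.le
  have hsub' : ((S \ T).card : ℝ) ≤ ε * S.card := by
    rwa [← Finset.card_sdiff_comm hcard]
  have hbound (A : Finset Γ) : |∑ t ∈ A, F t| ≤ A.card * C := by
    refine (Finset.abs_sum_le_sum_abs _ _).trans ?_
    rw [← nsmul_eq_mul]
    exact Finset.sum_le_card_nsmul _ _ _ fun t _ => hF t
  have hdiff : ∑ t ∈ T, F t - ∑ t ∈ S, F t = ∑ t ∈ T \ S, F t - ∑ t ∈ S \ T, F t := by
    rw [← Finset.sum_inter_add_sum_sdiff T S F, ← Finset.sum_inter_add_sum_sdiff S T F,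
      Finset.inter_comm]
    ring
  rw [finsetAverage, finsetAverage, ← sub_div, hTS, hdiff, abs_div, abs_of_pos hc,
    div_le_iff₀ hc]
  refine (abs_sub _ _).trans ((add_le_add (hbound _) (hbound _)).trans ?_)
  nlinarith

/-- A Følner amenable group carries a left-invariant mean on bounded real functions. -/
theorem Paper.FolnerAmenable.exists_invariant_mean (h : FolnerAmenable Γ) :
    ∃ M : (Γ → ℝ) → ℝ,
      (∀ F₁ F₂ : Γ → ℝ, (∃ C, ∀ t, |F₁ t| ≤ C) → (∃ C, ∀ t, |F₂ t| ≤ C) →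
        M (fun t => F₁ t + F₂ t) = M F₁ + M F₂) ∧
      (∀ (c : ℝ) (F : Γ → ℝ), (∃ C, ∀ t, |F t| ≤ C) → M (fun t => c * F t) = c * M F) ∧
      (∀ F : Γ → ℝ, (∃ C, ∀ t, |F t| ≤ C) → (∀ t, 0 ≤ F t) → 0 ≤ M F) ∧
      (∀ c : ℝ, M (fun _ => c) = c) ∧
      (∀ (s : Γ) (F : Γ → ℝ), (∃ C, ∀ t, |F t| ≤ C) → M (fun t => F (s * t)) = M F) := by
  classical
  have hpos (n : ℕ) : (0 : ℝ) < 1 / ((n : ℝ) + 1) := Nat.one_div_pos_of_nat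
  choose S hS using fun p : Finset Γ × ℕ => h p.1 _ (hpos p.2)
  let U : Ultrafilter (Finset Γ × ℕ) := Ultrafilter.of atTop
  have hU : (U : Filter (Finset Γ × ℕ)) ≤ atTop := Ultrafilter.of_le _
  let M : (Γ → ℝ) → ℝ := fun F => limUnder (U : Filter _) fun p => finsetAverage (S p) F
  have hmem {F : Γ → ℝ} {C : ℝ} (hF : ∀ t, |F t| ≤ C) (p) :
      finsetAverage (S p) F ∈ Set.Icc (-C) C :=
    finsetAverage_mem_Icc (hS p).nonempty fun t => abs_le.1 (hF t)
  have hlim {F : Γ → ℝ} (hF : ∃ C, ∀ t, |F t| ≤ C) :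
      Tendsto (fun p => finsetAverage (S p) F) U (𝓝 (M F)) := by
    obtain ⟨C, hC⟩ := hF
    obtain ⟨a, -, ha⟩ := isCompact_iff_ultrafilter_le_nhds.1 (isCompact_Icc (a := -C) (b := C))
      (U.map fun p => finsetAverage (S p) F)
      (le_principal_iff.2 (mem_map.2 (Eventually.of_forall fun p => hmem hC p)))
    exact tendsto_nhds_limUnder ⟨a, ha⟩
  refine ⟨M, fun F₁ F₂ h₁ h₂ => ?_, fun c F hF => ?_, fun F hF h0 => ?_, fun c => ?_,
    fun s F hF => ?_⟩
  · refine Tendsto.limUnder_eq (((hlim h₁).add (hlim h₂)).congr fun p => ?_)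
    simp only [finsetAverage, Finset.sum_add_distrib, add_div]
  · refine Tendsto.limUnder_eq (((hlim hF).const_mul c).congr fun p => ?_)
    simp only [finsetAverage, ← Finset.mul_sum, mul_div_assoc]
  · refine ge_of_tendsto' (hlim hF) fun p => ?_
    exact div_nonneg (Finset.sum_nonneg fun t _ => h0 t) (Nat.cast_nonneg _)
  · refine Tendsto.limUnder_eq (tendsto_const_nhds.congr fun p => ?_)
    have hc := finsetAverage_mem_Icc (hS p).nonempty (F := fun _ => c) (a := c) (b := c)
      fun _ => ⟨le_rfl, le_rfl⟩
    exact le_antisymm hc.1 hc.2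
  · obtain ⟨C, hC⟩ := hF
    have hdiff : Tendsto (fun p => finsetAverage (S p) (fun t => F (s * t)) -
        finsetAverage (S p) F) atTop (𝓝 0) := by
      have hbd : Tendsto (fun p : Finset Γ × ℕ => 2 * (1 / ((p.2 : ℝ) + 1)) * C)
          atTop (𝓝 0) := by
        have h2 : Tendsto (fun p : Finset Γ × ℕ => p.2) atTop atTop := by
          rw [← prod_atTop_atTop_eq]
          exact tendsto_snd
        simpa using ((tendsto_one_div_add_atTop_nhds_zero_nat.comp h2).const_mul 2).mul_const C
      refine squeeze_zero_norm' ?_ hbd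
      filter_upwards [eventually_ge_atTop (({s} : Finset Γ), 0)] with p hp
      exact (hS p).abs_finsetAverage_mul_left_sub_le (hp.1 (Finset.mem_singleton_self s)) hC
    refine Tendsto.limUnder_eq ?_
    simpa using (hdiff.mono_left hU).add (hlim ⟨C, hC⟩)

end InvariantMean

section Lifting

variable {X Y : Type*} [TopologicalSpace X] [CompactSpace X] [TopologicalSpace Y] [CompactSpace Y]

theorem ContinuousMap.integrable_of_compactSpace [MeasurableSpace X] [OpensMeasurableSpace X]
    (μ : Measure X) [IsFiniteMeasure μ] (f : C(X, ℝ)) : Integrable f μ :=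
  f.continuous.integrable_of_hasCompactSupport (HasCompactSupport.of_compactSpace f)

/-- Every positive linear functional on `C(X, ℝ)` is integration against a finite measure. -/
theorem exists_isFiniteMeasure_integral_eq [T2Space X] [MeasurableSpace X] [BorelSpace X]
    (L : C(X, ℝ) →ₗ[ℝ] ℝ) (hL : ∀ f, 0 ≤ f → 0 ≤ L f) :
    ∃ μ : Measure X, IsFiniteMeasure μ ∧ ∀ f : C(X, ℝ), ∫ x, f x ∂μ = L f := by
  let toC : CompactlySupportedContinuousMap X ℝ →ₗ[ℝ] C(X, ℝ) :=
    { toFun := fun f => f.toContinuousMap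
      map_add' := fun _ _ => rfl
      map_smul' := fun _ _ => rfl }
  let Λ := PositiveLinearMap.mk₀ (L ∘ₗ toC) fun f hf => hL _ hf
  refine ⟨RealRMK.rieszMeasure Λ, ⟨isCompact_univ.measure_lt_top⟩, fun f => ?_⟩
  exact RealRMK.integral_rieszMeasure Λ (CompactlySupportedContinuousMap.continuousMapEquiv f)

/-- Integration against a finite measure extends positively along a continuous surjection. -/
theorem exists_positive_extension_of_surjective [MeasurableSpace Y] [OpensMeasurableSpace Y]
    (ν : Measure Y) [IsFiniteMeasure ν] (p : C(X, Y)) (hp : Function.Surjective p) :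
    ∃ L : C(X, ℝ) →ₗ[ℝ] ℝ, (∀ f, 0 ≤ f → 0 ≤ L f) ∧
      ∀ g : C(Y, ℝ), L (g.comp p) = ∫ y, g y ∂ν := by
  let I : C(Y, ℝ) →ₗ[ℝ] ℝ :=
    { toFun := fun g => ∫ y, g y ∂ν
      map_add' := fun f g => integral_add (f.integrable_of_compactSpace ν)
        (g.integrable_of_compactSpace ν)
      map_smul' := fun c f => integral_const_mul c _ }
  let P : C(Y, ℝ) →ₗ[ℝ] C(X, ℝ) := (ContinuousMap.compRightAlgHom ℝ ℝ p).toLinearMap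
  have hP : Function.Injective P := fun f g hfg => by
    ext y
    obtain ⟨x, rfl⟩ := hp y
    exact DFunLike.congr_fun hfg x
  let e := LinearEquiv.ofInjective P hP
  obtain ⟨L, hL, hpos⟩ := riesz_extension (PointedCone.positive ℝ C(X, ℝ))
    ⟨LinearMap.range P, I ∘ₗ e.symm.toLinearMap⟩ (by
      intro f hf
      obtain ⟨g, rfl⟩ := e.surjective f
      simp only [LinearPMap.mk_apply, LinearMap.comp_apply, LinearEquiv.coe_coe,
        LinearEquiv.symm_apply_apply]
      refine integral_nonneg fun y => ?_
      obtain ⟨x, rfl⟩ := hp y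
      exact hf x) (by
      intro f
      refine ⟨e (ContinuousMap.const Y ‖f‖), ?_⟩
      intro x
      have := (abs_le.1 (f.norm_coe_le_norm x)).1
      change 0 ≤ ‖f‖ + f x
      linarith)
  refine ⟨L, fun f hf => hpos f hf, fun g => ?_⟩
  have := hL (e g)
  simpa [I, e, P] using this

end Lifting

/-- For a continuous surjection that is equivariant along an arbitrary map of groups `ρ`, with
amenable acting group, invariant probability measures lift. -/
theorem Paper.FolnerAmenable.exists_invProb_map_eq {Γ G X Y : Type*} [Group Γ] [Group G]
    (ham : FolnerAmenable Γ)
    [TopologicalSpace X] [CompactSpace X] [T2Space X] [HasOuterApproxClosed X]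
    [MeasurableSpace X] [BorelSpace X] [MulAction Γ X] [ContinuousConstSMul Γ X]
    [TopologicalSpace Y] [CompactSpace Y] [HasOuterApproxClosed Y]
    [MeasurableSpace Y] [BorelSpace Y] [MulAction G Y] [ContinuousConstSMul G Y]
    (ρ : Γ → G) (p : C(X, Y)) (hp : Function.Surjective p)
    (hequiv : ∀ (s : Γ) (x : X), p (s • x) = ρ s • p x)
    {ν : Measure Y} (hν : InvProb G Y ν) :
    ∃ μ : Measure X, InvProb Γ X μ ∧ μ.map p = ν := by
  obtain ⟨hν1, hνG⟩ := hν
  obtain ⟨L, hL, hLν⟩ := exists_positive_extension_of_surjective ν p hp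
  obtain ⟨M, hadd, hmul, hnonneg, hconst, hinv⟩ := ham.exists_invariant_mean
  let a (t : Γ) : C(X, X) := ⟨fun x => t • x, continuous_const_smul t⟩
  have hL1 : L 1 = 1 := by
    have := hLν 1
    simpa using this
  have hbd (f : C(X, ℝ)) : ∃ C, ∀ t, |L (f.comp (a t))| ≤ C := by
    refine ⟨‖f‖, fun t => abs_le.2 ?_⟩
    have h1 := hL (‖f‖ • 1 - f.comp (a t)) fun x => by
      have := (abs_le.1 (f.norm_coe_le_norm (t • x))).2
      simpa [a] using this
    have h2 := hL (‖f‖ • 1 + f.comp (a t)) fun x => by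
      have := (abs_le.1 (f.norm_coe_le_norm (t • x))).1
      change 0 ≤ ‖f‖ * 1 + f (t • x)
      linarith
    simp only [map_sub, map_add, map_smul, hL1, smul_eq_mul] at h1 h2
    constructor <;> linarith
  let N : C(X, ℝ) →ₗ[ℝ] ℝ :=
    { toFun := fun f => M fun t => L (f.comp (a t))
      map_add' := fun f g => by
        rw [← hadd _ _ (hbd f) (hbd g)]
        simp only [ContinuousMap.add_comp, map_add]
      map_smul' := fun c f => by
        rw [RingHom.id_apply, smul_eq_mul, ← hmul c _ (hbd f)]
        simp only [ContinuousMap.smul_comp, map_smul, smul_eq_mul] }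
  obtain ⟨μ, hμ, hμN⟩ := exists_isFiniteMeasure_integral_eq N fun f hf =>
    hnonneg _ (hbd f) fun t => hL _ fun x => hf (t • x)
  have hNν (g : C(Y, ℝ)) : N (g.comp p) = ∫ y, g y ∂ν := by
    have key (t : Γ) : L ((g.comp p).comp (a t)) = ∫ y, g y ∂ν := by
      let b : C(Y, Y) := ⟨fun y => ρ t • y, continuous_const_smul (ρ t)⟩
      have hcomp : (g.comp p).comp (a t) = (g.comp b).comp p := by
        ext x
        exact congrArg g (hequiv t x)
      rw [hcomp, hLν]
      conv_rhs => rw [← hνG (ρ t)]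
      rw [integral_map (continuous_const_smul (ρ t)).aemeasurable
        g.continuous.aestronglyMeasurable]
      rfl
    change M (fun t => L ((g.comp p).comp (a t))) = _
    simp only [key, hconst]
  have hmap : μ.map p = ν := by
    refine ext_of_forall_integral_eq_of_IsFiniteMeasure fun g => ?_
    rw [integral_map p.continuous.aemeasurable g.continuous.aestronglyMeasurable]
    exact (hμN (g.toContinuousMap.comp p)).trans (hNν g.toContinuousMap)
  refine ⟨μ, ⟨⟨?_⟩, fun s => ?_⟩, hmap⟩
  · rw [← Set.preimage_univ (f := p), ← Measure.map_apply p.continuous.measurable .univ, hmap,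
      measure_univ]
  · refine ext_of_forall_integral_eq_of_IsFiniteMeasure fun f => ?_
    rw [integral_map (continuous_const_smul s).aemeasurable f.continuous.aestronglyMeasurable]
    refine (hμN (f.toContinuousMap.comp (a s))).trans (Eq.trans ?_ (hμN f.toContinuousMap).symm)
    refine Eq.trans ?_ (hinv s _ (hbd f.toContinuousMap))
    change M _ = M _
    congr 1
    ext t
    congr 1
    ext x
    exact congrArg f (mul_smul s t x).symm

theorem essFree_quotient
    (Γ : Type*) [Group Γ] [Countable Γ] (ham : FolnerAmenable Γ)
    (H : Subgroup Γ) [H.Normal]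
    (X : Type*) [MetricSpace X] [CompactSpace X]
    [MeasurableSpace X] [BorelSpace X]
    [MulAction Γ X] [ContinuousConstSMul Γ X]
    (Y : Type*) [TopologicalSpace Y] [T2Space Y]
    [MeasurableSpace Y] [BorelSpace Y]
    [MulAction (Γ ⧸ H) Y] [ContinuousConstSMul (Γ ⧸ H) Y]
    (π : X → Y) (hq : Topology.IsQuotientMap π)
    (hfib : ∀ x x' : X, π x = π x' ↔ x' ∈ MulAction.orbit H x)
    (hequiv : ∀ (s : Γ) (x : X), π (s • x) = (QuotientGroup.mk s : Γ ⧸ H) • π x)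
    (hX : EssFree Γ X) :
    EssFree (Γ ⧸ H) Y := by
  have hopen : IsOpenMap π := by
    intro U hU
    rw [← hq.isOpen_preimage]
    have hpre : π ⁻¹' (π '' U) = ⋃ h : H, (fun x : X => h • x) ⁻¹' U := by
      ext x
      simp only [Set.mem_preimage, Set.mem_image, Set.mem_iUnion]
      constructor
      · rintro ⟨u, hu, hux⟩
        obtain ⟨h, rfl⟩ := (hfib x u).1 hux.symm
        exact ⟨h, hu⟩
      · rintro ⟨h, hx⟩
        exact ⟨_, hx, ((hfib x _).2 ⟨h, rfl⟩).symm⟩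
    rw [hpre]
    exact isOpen_iUnion fun h => hU.preimage (continuous_const_smul (h : Γ))
  have : CompactSpace Y := hq.surjective.compactSpace hq.continuous
  have : SecondCountableTopology Y := hq.secondCountableTopology hopen
  intro g hg ν hν
  obtain ⟨s, rfl⟩ := QuotientGroup.mk_surjective g
  obtain ⟨μ, hμ, hmap⟩ := ham.exists_invProb_map_eq (QuotientGroup.mk : Γ → Γ ⧸ H)
    ⟨π, hq.continuous⟩ hq.surjective hequiv hν
  rw [ContinuousMap.coe_mk] at hmap
  have hclosed : IsClosed {y : Y | (QuotientGroup.mk s : Γ ⧸ H) • y = y} :=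
    isClosed_eq (continuous_const_smul _) continuous_id
  rw [← hmap, Measure.map_apply hq.continuous.measurable hclosed.measurableSet]
  have hsub : π ⁻¹' {y : Y | (QuotientGroup.mk s : Γ ⧸ H) • y = y} ⊆
      ⋃ h : H, {x : X | ((h : Γ)⁻¹ * s) • x = x} := by
    intro x hx
    obtain ⟨h, hh⟩ := (hfib x (s • x)).1 ((hequiv s x).trans hx).symm
    refine Set.mem_iUnion.2 ⟨h, ?_⟩
    rw [Set.mem_ofPred_eq, mul_smul, inv_smul_eq_iff]
    exact hh.symm
  refine measure_mono_null hsub (measure_iUnion_null fun h => hX _ (fun hs => hg ?_) μ hμ)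
  rw [QuotientGroup.eq_one_iff, ← inv_mul_eq_one.1 hs]
  exact h.2
end
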